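/- arXiv:1811.05072 — 2 statements merged into one kernel-verified Lean document; each statement's English description precedes it below -/
import Mathlib

section
/- Let ε ∈ (0,1), δ ∈ (0,1), Δ > 0, and σ ≥ √(2·ln(1.25/δ))/ε. Let n be a natural number and let v, w : Fin n → ℝ be two vectors with Euclidean distance ‖v − w‖₂ ≤ Δ. Then the product Gaussian measures Measure.pi (fun i => gaussianReal (v i) ((Δσ)²)) and Measure.pi (fun i => gaussianReal (w i) ((Δσ)²)) are (ε,δ)-indistinguishable: for every measurable set S ⊆ (Fin n → ℝ), the first measure of S is at most exp(ε) times the second measure of S, plus δ. (This is the multivariate Gaussian mechanism adding noise N(0, σ²Δ²·I) to a vector-valued function of L2-sensitivity Δ, as used to sanitize the batch loss in Algorithm 2.) -/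
open MeasureTheory ProbabilityTheory Real

lemma pi_gaussian_withDensity (n : ℕ) (m : Fin n → ℝ) (V : NNReal) (hV : V ≠ 0) :
    Measure.pi (fun i => gaussianReal (m i) V) =
      (volume : Measure (Fin n → ℝ)).withDensity
        (fun x => ENNReal.ofReal (∏ i, gaussianPDFReal (m i) V (x i))) := by
  apply Measure.pi_eq
  intro s hs
  rw [withDensity_apply _ (MeasurableSet.univ_pi hs), volume_pi, Measure.restrict_pi_pi,
    ← ofReal_integral_eq_lintegral_ofReal, integral_fintype_prod_eq_prod
      (f := fun i (y : ℝ) => gaussianPDFReal (m i) V y),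
    ENNReal.ofReal_prod_of_nonneg]
  · refine Finset.prod_congr rfl fun i _ => ?_
    rw [gaussianReal_apply_eq_integral _ hV]
  · intro i _
    exact integral_nonneg fun y => gaussianPDFReal_nonneg _ _ _
  · exact Integrable.fintype_prod (f := fun i (y : ℝ) => gaussianPDFReal (m i) V y)
      fun i => (integrable_gaussianPDFReal _ _).restrict
  · exact Filter.Eventually.of_forall fun x =>
      Finset.prod_nonneg fun i _ => gaussianPDFReal_nonneg _ _ _

lemma prod_pdf (n : ℕ) (m x : Fin n → ℝ) (V : NNReal) :
    ∏ i, gaussianPDFReal (m i) V (x i) =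
      ((√(2 * π * V))⁻¹) ^ n * rexp (-(∑ i, (x i - m i) ^ 2) / (2 * V)) := by
  simp only [gaussianPDFReal, Finset.prod_mul_distrib, Finset.prod_const, Finset.card_univ,
    Fintype.card_fin, ← Real.exp_sum, ← Finset.sum_div, Finset.sum_neg_distrib]

/-- The key bound, from a pointwise density comparison. -/
lemma key (ε s K : ℝ) (n : ℕ) (v w : Fin n → ℝ) (V : NNReal) (hV : V ≠ 0) (hK : 0 ≤ K)
    (hs : ∀ l : ℝ, rexp l - 1 ≤ K * rexp ((1 + s) * l))
    (S : Set (Fin n → ℝ)) (hS : MeasurableSet S) :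
    Measure.pi (fun i => gaussianReal (v i) V) S ≤
      ENNReal.ofReal (Real.exp ε) * Measure.pi (fun i => gaussianReal (w i) V) S +
        ENNReal.ofReal
          (K * rexp (s * (1 + s) * (∑ i, (v i - w i) ^ 2) / (2 * V) - s * ε)) := by
  set C := K * rexp (s * (1 + s) * (∑ i, (v i - w i) ^ 2) / (2 * V) - s * ε) with hC
  have hC0 : 0 ≤ C := by positivity
  let u : Fin n → ℝ := fun i => v i + s * (v i - w i)
  have hV' : (0 : ℝ) < V := by positivity
  have hmeas : ∀ m : Fin n → ℝ, Measurable
      (fun x : Fin n → ℝ => ENNReal.ofReal (∏ i, gaussianPDFReal (m i) V (x i))) := by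
    intro m
    refine ENNReal.measurable_ofReal.comp (Finset.measurable_prod _ fun i _ => ?_)
    exact (measurable_gaussianPDFReal _ _).comp (measurable_pi_apply i)
  have hpt : ∀ x : Fin n → ℝ, ∏ i, gaussianPDFReal (v i) V (x i) ≤
      rexp ε * ∏ i, gaussianPDFReal (w i) V (x i) + C * ∏ i, gaussianPDFReal (u i) V (x i) := by
    intro x
    rw [prod_pdf, prod_pdf, prod_pdf]
    set A := ((√(2 * π * V))⁻¹) ^ n
    have hA : 0 ≤ A := by positivity
    have hu : ∑ i, (x i - u i) ^ 2 = (1 + s) * ∑ i, (x i - v i) ^ 2 - s * ∑ i, (x i - w i) ^ 2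
        + s * (1 + s) * ∑ i, (v i - w i) ^ 2 := by
      rw [Finset.mul_sum, Finset.mul_sum, Finset.mul_sum, ← Finset.sum_sub_distrib,
        ← Finset.sum_add_distrib]
      refine Finset.sum_congr rfl fun i _ => ?_
      simp only [u]; ring
    rw [hu, hC]
    set a := ∑ i, (x i - v i) ^ 2
    set b := ∑ i, (x i - w i) ^ 2
    set D := ∑ i, (v i - w i) ^ 2
    have h := hs (-a / (2 * V) + b / (2 * V) - ε)
    have h2 := mul_le_mul_of_nonneg_left h (mul_nonneg hA (exp_pos (ε - b / (2 * V))).le)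
    have e1 : rexp (-a / (2 * V)) = rexp (ε - b / (2 * V)) * rexp (-a / (2 * V) + b / (2 * V) - ε) := by
      rw [← Real.exp_add]; congr 1; ring
    have e2 : rexp ε * rexp (-b / (2 * V)) = rexp (ε - b / (2 * V)) := by
      rw [← Real.exp_add]; congr 1; ring
    have e3 : rexp (s * (1 + s) * D / (2 * V) - s * ε) *
        rexp (-((1 + s) * a - s * b + s * (1 + s) * D) / (2 * V)) =
        rexp (ε - b / (2 * V)) * rexp ((1 + s) * (-a / (2 * V) + b / (2 * V) - ε)) := by
      rw [← Real.exp_add, ← Real.exp_add]; congr 1; field_simp; ring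
    calc A * rexp (-a / (2 * V)) = A * rexp (ε - b / (2 * V)) *
          (rexp (-a / (2 * V) + b / (2 * V) - ε) - 1) + A * rexp (ε - b / (2 * V)) := by
          rw [e1]; ring
      _ ≤ A * rexp (ε - b / (2 * V)) * (K * rexp ((1 + s) * (-a / (2 * V) + b / (2 * V) - ε)))
          + A * rexp (ε - b / (2 * V)) := by linarith
      _ = A * (rexp ε * rexp (-b / (2 * V))) + A * K * (rexp (s * (1 + s) * D / (2 * V) - s * ε) *
        rexp (-((1 + s) * a - s * b + s * (1 + s) * D) / (2 * V))) := by rw [e2, e3]; ring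
      _ = _ := by ring
  have hu1 : Measure.pi (fun i => gaussianReal (u i) V) S ≤ 1 := prob_le_one
  calc Measure.pi (fun i => gaussianReal (v i) V) S
      ≤ ENNReal.ofReal (Real.exp ε) * Measure.pi (fun i => gaussianReal (w i) V) S +
        ENNReal.ofReal C * Measure.pi (fun i => gaussianReal (u i) V) S := by
        simp only [pi_gaussian_withDensity _ _ V hV]
        rw [withDensity_apply _ hS, withDensity_apply _ hS, withDensity_apply _ hS,
          ← lintegral_const_mul _ (hmeas w), ← lintegral_const_mul _ (hmeas u),
          ← lintegral_add_left ((hmeas w).const_mul _)]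
        refine lintegral_mono fun x => ?_
        simp only
        have hw0 : 0 ≤ ∏ i, gaussianPDFReal (w i) V (x i) :=
          Finset.prod_nonneg fun i _ => gaussianPDFReal_nonneg _ _ _
        have hu0 : 0 ≤ ∏ i, gaussianPDFReal (u i) V (x i) :=
          Finset.prod_nonneg fun i _ => gaussianPDFReal_nonneg _ _ _
        rw [← ENNReal.ofReal_mul (exp_pos _).le, ← ENNReal.ofReal_mul hC0,
          ← ENNReal.ofReal_add (by positivity) (by positivity)]
        exact ENNReal.ofReal_le_ofReal (hpt x)
    _ ≤ _ := by
        gcongr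
        exact mul_le_of_le_one_right' hu1

lemma exp_le_five : rexp 1.6 ≤ 5 := by
  have h : rexp 1.6 ^ 5 ≤ 5 ^ 5 := by
    rw [← Real.exp_nat_mul, show ((5 : ℕ) : ℝ) * 1.6 = (8 : ℕ) * 1 by norm_num, Real.exp_nat_mul]
    calc rexp 1 ^ 8 ≤ 2.7182818286 ^ 8 := by gcongr; exact Real.exp_one_lt_d9.le
      _ ≤ 5 ^ 5 := by norm_num
  exact le_of_pow_le_pow_left₀ (by norm_num) (by norm_num) h

lemma exp_le_165 : rexp (1/2) ≤ 1.65 := by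
  have h : rexp (1/2) ^ 2 ≤ 1.65 ^ 2 := by
    rw [← Real.exp_nat_mul, show ((2 : ℕ) : ℝ) * (1/2) = 1 by norm_num]
    exact Real.exp_one_lt_d9.le.trans (by norm_num)
  exact le_of_pow_le_pow_left₀ (by norm_num) (by norm_num) h

lemma log_ge : 0.22 ≤ Real.log 1.25 := by
  rw [Real.le_log_iff_exp_le (by norm_num)]
  have h : rexp 0.22 ^ 50 ≤ 1.25 ^ 50 := by
    rw [← Real.exp_nat_mul, show ((50 : ℕ) : ℝ) * 0.22 = (11 : ℕ) * 1 by norm_num, Real.exp_nat_mul]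
    calc rexp 1 ^ 11 ≤ 2.7182818286 ^ 11 := by gcongr; exact Real.exp_one_lt_d9.le
      _ ≤ 1.25 ^ 50 := by norm_num
  exact le_of_pow_le_pow_left₀ (by norm_num) (by norm_num) h

lemma bern (s : ℝ) (hs : 0 ≤ s) (l : ℝ) : rexp l - 1 ≤ 1 / (1 + s) * rexp ((1 + s) * l) := by
  have h := one_add_mul_self_le_rpow_one_add (s := rexp l - 1) (by linarith [exp_pos l])
    (p := 1 + s) (by linarith)
  rw [add_sub_cancel, ← Real.exp_mul, mul_comm l] at h
  rw [one_div, ← div_eq_inv_mul, le_div_iff₀ (by linarith)]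
  linarith

lemma amgm (l : ℝ) : rexp l - 1 ≤ 1 / 4 * rexp ((1 + 1) * l) := by
  rw [show (1 + 1) * l = l + l by ring, Real.exp_add]
  nlinarith [sq_nonneg (rexp l - 2)]

theorem multivariate_gaussian_mechanism_dp
    (ε δ Δ σ : ℝ)
    (hε : 0 < ε) (hε1 : ε < 1)
    (hδ : 0 < δ) (hδ1 : δ < 1)
    (hΔ : 0 < Δ)
    (hσ : Real.sqrt (2 * Real.log (1.25 / δ)) / ε ≤ σ)
    (n : ℕ) (v w : Fin n → ℝ)
    (hvw : Real.sqrt (∑ i, (v i - w i) ^ 2) ≤ Δ)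
    (S : Set (Fin n → ℝ)) (hS : MeasurableSet S) :
    Measure.pi (fun i => gaussianReal (v i) (((Δ * σ) ^ 2).toNNReal)) S ≤
      ENNReal.ofReal (Real.exp ε) *
        Measure.pi (fun i => gaussianReal (w i) (((Δ * σ) ^ 2).toNNReal)) S +
        ENNReal.ofReal δ := by
  have hlog : Real.log 1.25 ≤ Real.log (1.25 / δ) := by
    apply Real.log_le_log (by norm_num)
    rw [le_div_iff₀ hδ]; linarith
  have hL : 0.22 ≤ Real.log (1.25 / δ) := log_ge.trans hlog
  have hsq : 0 < Real.sqrt (2 * Real.log (1.25 / δ)) := Real.sqrt_pos.2 (by linarith)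
  have hσ0 : 0 < σ := lt_of_lt_of_le (div_pos hsq hε) hσ
  obtain ⟨x, hx⟩ : ∃ x, x = (σ * ε) ^ 2 := ⟨_, rfl⟩
  have hxL : 2 * Real.log (1.25 / δ) ≤ x := by
    rw [div_le_iff₀ hε] at hσ
    rw [hx, ← Real.sqrt_le_left (by positivity)]
    exact hσ
  have hx0 : 0.44 ≤ x := by linarith
  have hxp : 0 < x := by linarith
  have hδx : 1.25 * rexp (-x / 2) ≤ δ := by
    have h1 : rexp (-x / 2) ≤ rexp (-Real.log (1.25 / δ)) := Real.exp_le_exp.2 (by linarith)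
    rw [Real.exp_neg, Real.exp_log (by positivity), inv_div, le_div_iff₀ (by norm_num)] at h1
    linarith
  have hD : ∑ i, (v i - w i) ^ 2 ≤ Δ ^ 2 := (Real.sqrt_le_left hΔ.le).1 hvw
  have hVr : (0 : ℝ) < (Δ * σ) ^ 2 := by positivity
  have hV : ((Δ * σ) ^ 2).toNNReal ≠ 0 := (Real.toNNReal_pos.2 hVr).ne'
  have hexp : ∀ s : ℝ, 0 ≤ s →
      s * (1 + s) * (∑ i, (v i - w i) ^ 2) / (2 * (((Δ * σ) ^ 2).toNNReal : ℝ)) - s * ε ≤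
        s * (1 + s) * ε ^ 2 / (2 * x) - s * ε := by
    intro s hs
    rw [Real.coe_toNNReal _ hVr.le, hx]
    have : s * (1 + s) * ε ^ 2 / (2 * (σ * ε) ^ 2) = s * (1 + s) * Δ ^ 2 / (2 * (Δ * σ) ^ 2) := by
      field_simp
    rw [this]
    gcongr
  by_cases hx1 : x ≤ 0.82
  · refine (key ε 1 (1/4) n v w _ hV (by norm_num) amgm S hS).trans ?_
    gcongr
    refine le_trans ?_ hδx
    have h1 : (1:ℝ) * (1 + 1) * ε ^ 2 / (2 * x) - 1 * ε ≤ 1.6 + -x / 2 := by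
      have : (1:ℝ) * (1 + 1) * ε ^ 2 / (2 * x) = ε ^ 2 / x := by field_simp; norm_num
      rw [this]
      have h2 : ε ^ 2 / x ≤ 1.6 + -x / 2 + ε := by
        rw [div_le_iff₀ hxp]
        nlinarith [mul_nonneg hε.le (sub_nonneg.2 hε1.le), mul_nonneg (sub_nonneg.2 hx0) (sub_nonneg.2 hx1), mul_nonneg (sub_nonneg.2 hx0) (sub_nonneg.2 hε1.le)]
      linarith
    have h3 := Real.exp_le_exp.2 ((hexp 1 zero_le_one).trans h1)
    rw [Real.exp_add] at h3
    have h4 := mul_le_mul_of_nonneg_right exp_le_five (exp_pos (-x / 2)).le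
    linarith
  · push Not at hx1
    obtain ⟨s, hs⟩ : ∃ s, s = x / ε - 1 / 2 := ⟨_, rfl⟩
    have hxe : x ≤ x / ε := by rw [le_div_iff₀ hε]; nlinarith
    have hs0 : 0 ≤ s := by linarith
    refine (key ε s (1 / (1 + s)) n v w _ hV (by positivity) (bern s hs0) S hS).trans ?_
    gcongr
    refine le_trans ?_ hδx
    have h1 : s * (1 + s) * ε ^ 2 / (2 * x) - s * ε ≤ 1 / 2 + -x / 2 := by
      have : s * (1 + s) * ε ^ 2 / (2 * x) - s * ε = -x / 2 + ε / 2 - ε ^ 2 / (8 * x) := by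
        rw [hs]; field_simp; ring
      rw [this]
      have : 0 ≤ ε ^ 2 / (8 * x) := by positivity
      linarith
    have h3 := Real.exp_le_exp.2 ((hexp s hs0).trans h1)
    rw [Real.exp_add] at h3
    have h4 := mul_le_mul_of_nonneg_right exp_le_165 (exp_pos (-x / 2)).le
    rw [one_div, ← div_eq_inv_mul, div_le_iff₀ (by linarith)]
    have h5 : 0 < rexp (-x / 2) := exp_pos _
    nlinarith
end

section
/- Let σ > 0, Δ > 0, ε > 0, and let x be a real number with |x| ≤ σ²·ε/Δ − Δ/2. Then the density of the Gaussian N(0,σ²) at x is at most exp(ε) times the density of the Gaussian N(Δ,σ²) at x, and conversely the density of N(Δ,σ²) at x is at most exp(ε) times the density of N(0,σ²) at x. Equivalently, the log-likelihood ratio satisfies |Δ·(Δ − 2x)/(2σ²)| ≤ ε. -/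
open MeasureTheory ProbabilityTheory Real

theorem gaussian_pointwise_privacy_loss_bound
    (σ Δ ε x : ℝ)
    (hσ : 0 < σ) (hΔ : 0 < Δ) (hε : 0 < ε)
    (hx : |x| ≤ σ ^ 2 * ε / Δ - Δ / 2) :
    gaussianPDFReal 0 ((σ ^ 2).toNNReal) x ≤
        Real.exp ε * gaussianPDFReal Δ ((σ ^ 2).toNNReal) x ∧
      gaussianPDFReal Δ ((σ ^ 2).toNNReal) x ≤
        Real.exp ε * gaussianPDFReal 0 ((σ ^ 2).toNNReal) x ∧
      |Δ * (Δ - 2 * x) / (2 * σ ^ 2)| ≤ ε := by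
  have hs : 0 < σ ^ 2 := by positivity
  have hkey : |Δ * (Δ - 2 * x) / (2 * σ ^ 2)| ≤ ε := by
    have h1 : Δ * (|x| + Δ / 2) ≤ σ ^ 2 * ε := by
      have h2 : |x| + Δ / 2 ≤ σ ^ 2 * ε / Δ := by linarith
      rw [le_div_iff₀ hΔ] at h2
      linarith
    have h3 := mul_le_mul_of_nonneg_left (le_abs_self x) hΔ.le
    have h4 := mul_le_mul_of_nonneg_left (neg_abs_le x) hΔ.le
    have h5 : 0 < Δ * Δ := by positivity
    rw [abs_le]
    constructor
    · rw [le_div_iff₀ (by positivity)]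
      nlinarith
    · rw [div_le_iff₀ (by positivity)]
      nlinarith
  have hk := abs_le.mp hkey
  have e : -(x - 0) ^ 2 / (2 * σ ^ 2) - -(x - Δ) ^ 2 / (2 * σ ^ 2)
      = Δ * (Δ - 2 * x) / (2 * σ ^ 2) := by ring
  refine ⟨?_, ?_, hkey⟩
  all_goals
    simp only [gaussianPDFReal, Real.coe_toNNReal _ hs.le]
    rw [mul_left_comm, ← Real.exp_add]
    refine mul_le_mul_of_nonneg_left (Real.exp_le_exp.mpr ?_) (by positivity)
    linarith [hk.1, hk.2]
end
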